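/- arXiv:1903.02502 — 5 statements merged into one kernel-verified Lean document; each statement's English description precedes it below -/
import Mathlib

section
/- The metric compactification of the real line (ℝ, |·|) consists exactly of the internal metric functionals together with the two functions s ↦ s and s ↦ −s: the closure, in the topology of pointwise convergence on ℝ^ℝ, of the set { s ↦ |s−r| − |r| : r ∈ ℝ } equals { s ↦ |s−r| − |r| : r ∈ ℝ } ∪ { s ↦ −s, s ↦ s }. -/
open Filter Topology

theorem tendsto_abs_sub_sub_abs_atTop :
    Tendsto (fun r s : ℝ => |s - r| - |r|) atTop (𝓝 fun s => -s) := by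
  refine tendsto_pi_nhds.2 fun s => tendsto_const_nhds.congr' ?_
  filter_upwards [eventually_ge_atTop s, eventually_ge_atTop 0] with r hs h0
  rw [abs_of_nonpos (sub_nonpos.2 hs), abs_of_nonneg h0]
  ring

theorem tendsto_abs_sub_sub_abs_atBot :
    Tendsto (fun r s : ℝ => |s - r| - |r|) atBot (𝓝 fun s => s) := by
  refine tendsto_pi_nhds.2 fun s => tendsto_const_nhds.congr' ?_
  filter_upwards [eventually_le_atBot s, eventually_le_atBot 0] with r hs h0
  rw [abs_of_nonneg (sub_nonneg.2 hs), abs_of_nonpos h0]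
  ring

theorem Ultrafilter.real_le_atBot_or_le_nhds_or_le_atTop (u : Ultrafilter ℝ) :
    (u : Filter ℝ) ≤ atBot ∨ (∃ r, (u : Filter ℝ) ≤ 𝓝 r) ∨ (u : Filter ℝ) ≤ atTop := by
  obtain ⟨x, -, hx⟩ := isCompact_univ.ultrafilter_le_nhds (u.map ((↑) : ℝ → EReal)) (by simp)
  have hx : Tendsto ((↑) : ℝ → EReal) u (𝓝 x) := hx
  induction x with
  | bot => exact .inl (EReal.tendsto_coe_nhds_bot_iff.1 hx)
  | coe r => exact .inr (.inl ⟨r, EReal.tendsto_coe.1 hx⟩)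
  | top => exact .inr (.inr (EReal.tendsto_coe_nhds_top_iff.1 hx))

/-- The metric compactification of `(ℝ, |·|)` (with base point `0`): the closure, in the
topology of pointwise convergence on `ℝ^ℝ`, of the set of internal metric functionals
`s ↦ |s − r| − |r|` consists exactly of these internal metric functionals together with
the two functions `s ↦ −s` and `s ↦ s`. -/
theorem metric_compactification_of_real_line :
    closure {F : ℝ → ℝ | ∃ r : ℝ, F = fun s => |s - r| - |r|} =
      {F : ℝ → ℝ | ∃ r : ℝ, F = fun s => |s - r| - |r|} ∪
        {fun s => -s, fun s => s} := by
  apply Set.Subset.antisymm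
  · intro F hF
    have : (comap (fun r s : ℝ => |s - r| - |r|) (𝓝 F)).NeBot :=
      comap_neBot_iff_frequently.2 <| (mem_closure_iff_frequently.1 hF).mono
        fun G ⟨r, hr⟩ => ⟨r, hr.symm⟩
    obtain ⟨u, hle⟩ := Ultrafilter.exists_le (comap (fun r s : ℝ => |s - r| - |r|) (𝓝 F))
    have hu : Tendsto (fun r s : ℝ => |s - r| - |r|) u (𝓝 F) := tendsto_iff_comap.2 hle
    rcases u.real_le_atBot_or_le_nhds_or_le_atTop with h | ⟨r, h⟩ | h
    · exact .inr (.inr (tendsto_nhds_unique hu (tendsto_abs_sub_sub_abs_atBot.mono_left h)))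
    · have hcont : Continuous fun r s : ℝ => |s - r| - |r| := by fun_prop
      exact .inl ⟨r, tendsto_nhds_unique hu ((hcont.tendsto r).mono_left h)⟩
    · exact .inr (.inl (tendsto_nhds_unique hu (tendsto_abs_sub_sub_abs_atTop.mono_left h)))
  · refine Set.union_subset subset_closure ?_
    rintro F (rfl | rfl)
    · exact mem_closure_of_tendsto tendsto_abs_sub_sub_abs_atTop (.of_forall fun r => ⟨r, rfl⟩)
    · exact mem_closure_of_tendsto tendsto_abs_sub_sub_abs_atBot (.of_forall fun r => ⟨r, rfl⟩)
end

section
/- Let Ω = [0,1] with Lebesgue measure ℙ, and for n ∈ ℕ let A_n = [1/2 − 1/(n+1), 1/2] and B_n = (1/2, 1/2 + 1/(n+1)], and define g_n = −n²·1_{A_n} + n²·1_{B_n}. Then ‖g_n‖_{L_1} = 2n²/(n+1) → ∞ as n → ∞, yet for every f ∈ L_1([0,1]) one has ‖f − g_n‖_{L_1} − ‖g_n‖_{L_1} → ‖f‖_{L_1} as n → ∞; in particular, the internal metric functionals h_{g_n} converge pointwise to the internal metric functional h_0 even though (g_n) does not converge to 0 in L_1-norm. -/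
open MeasureTheory Filter Topology

/-- Lebesgue measure restricted to `[0,1]`. -/
noncomputable def μ01 : Measure ℝ := volume.restrict (Set.Icc (0 : ℝ) 1)

/-- If the integrable functions `gₙ` vanish eventually at almost every point, then
`‖f - gₙ‖₁ - ‖gₙ‖₁ → ‖f‖₁` for every integrable `f`, whether or not `‖gₙ‖₁` stays bounded. -/
lemma tendsto_integral_abs_sub_sub_integral_abs {α : Type*} [MeasurableSpace α] {μ : Measure α}
    {f : α → ℝ} {g : ℕ → α → ℝ} (hf : Integrable f μ) (hg : ∀ n, Integrable (g n) μ)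
    (hzero : ∀ᵐ ω ∂μ, ∀ᶠ n in atTop, g n ω = 0) :
    Tendsto (fun n => (∫ ω, |f ω - g n ω| ∂μ) - ∫ ω, |g n ω| ∂μ) atTop
      (𝓝 (∫ ω, |f ω| ∂μ)) := by
  have hsub : ∀ n, (∫ ω, |f ω - g n ω| ∂μ) - ∫ ω, |g n ω| ∂μ
      = ∫ ω, (|f ω - g n ω| - |g n ω|) ∂μ := fun n =>
    (integral_sub (hf.sub (hg n)).abs (hg n).abs).symm
  simp only [hsub]
  refine tendsto_integral_of_dominated_convergence (fun ω => |f ω|)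
    (fun n => ((hf.sub (hg n)).abs.sub (hg n).abs).aestronglyMeasurable) hf.abs
    (fun n => ae_of_all _ fun ω => ?_) ?_
  · have := abs_abs_sub_abs_le (f ω - g n ω) (-g n ω)
    simpa using this
  · filter_upwards [hzero] with ω hω
    refine tendsto_const_nhds.congr' ?_
    filter_upwards [hω] with n hn
    simp [hn]

instance : IsFiniteMeasure μ01 := by
  unfold μ01
  infer_instance

lemma abs_indicator_Icc_add_indicator_Ioc (a b c r ω : ℝ) :
    |(Set.Icc a b).indicator (fun _ => -r ^ 2) ω + (Set.Ioc b c).indicator (fun _ => r ^ 2) ω|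
      = (Set.Icc a b).indicator (fun _ => r ^ 2) ω
        + (Set.Ioc b c).indicator (fun _ => r ^ 2) ω := by
  by_cases h₁ : ω ∈ Set.Icc a b
  · have h₂ : ω ∉ Set.Ioc b c := fun h => absurd h.1 (not_lt.2 h₁.2)
    simp [h₁, h₂]
  · by_cases h₂ : ω ∈ Set.Ioc b c <;> simp [h₁, h₂]

/-- With `Aₙ = [1/2 − 1/(n+1), 1/2]`, `Bₙ = (1/2, 1/2 + 1/(n+1)]` and
`gₙ = −n²·1_{Aₙ} + n²·1_{Bₙ}`, the `L₁`-norms `‖gₙ‖ = 2n²/(n+1)` tend to infinity, yet the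
internal metric functionals `h_{gₙ}` converge pointwise on `L₁([0,1])` to `h₀ = ‖·‖`. -/
theorem unbounded_sequence_converging_to_internal_functional
    (A B : ℕ → Set ℝ)
    (hA : ∀ n, A n = Set.Icc (1 / 2 - 1 / ((n : ℝ) + 1)) (1 / 2))
    (hB : ∀ n, B n = Set.Ioc (1 / 2) (1 / 2 + 1 / ((n : ℝ) + 1)))
    (g : ℕ → ℝ → ℝ)
    (hg : ∀ n, g n = fun ω => (A n).indicator (fun _ => -(n : ℝ) ^ 2) ω
        + (B n).indicator (fun _ => (n : ℝ) ^ 2) ω) :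
    (∀ n, ∫ ω, |g n ω| ∂μ01 = 2 * (n : ℝ) ^ 2 / (n + 1)) ∧
    Tendsto (fun n => ∫ ω, |g n ω| ∂μ01) atTop atTop ∧
    ∀ f : ℝ → ℝ, Integrable f μ01 →
      Tendsto (fun n => (∫ ω, |f ω - g n ω| ∂μ01) - ∫ ω, |g n ω| ∂μ01) atTop
        (𝓝 (∫ ω, |f ω| ∂μ01)) := by
  have hint : ∀ n, Integrable (g n) μ01 := fun n => by
    rw [hg, hA, hB]
    exact ((integrable_const _).indicator measurableSet_Icc).add
      ((integrable_const _).indicator measurableSet_Ioc)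
  have hnorm : ∀ n : ℕ, ∫ ω, |g n ω| ∂μ01 = 2 * (n : ℝ) ^ 2 / (n + 1) := by
    intro n
    rcases Nat.eq_zero_or_pos n with rfl | hn
    · simp [hg]
    have hn' : (1 : ℝ) ≤ n := by exact_mod_cast hn
    have hr : 1 / ((n : ℝ) + 1) ≤ 1 / 2 := by
      apply one_div_le_one_div_of_le <;> linarith
    have hr0 : 0 ≤ 1 / ((n : ℝ) + 1) := by positivity
    have hsubA : Set.Icc (1 / 2 - 1 / ((n : ℝ) + 1)) (1 / 2) ⊆ Set.Icc 0 1 :=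
      Set.Icc_subset_Icc (by linarith) (by norm_num)
    have hsubB : Set.Ioc (1 / 2) (1 / 2 + 1 / ((n : ℝ) + 1)) ⊆ Set.Icc 0 1 :=
      Set.Ioc_subset_Icc_self.trans (Set.Icc_subset_Icc (by norm_num) (by linarith))
    simp only [hg, hA, hB, abs_indicator_Icc_add_indicator_Ioc]
    rw [integral_add ((integrable_const _).indicator measurableSet_Icc)
      ((integrable_const _).indicator measurableSet_Ioc),
      integral_indicator_const _ measurableSet_Icc, integral_indicator_const _ measurableSet_Ioc,
      μ01, measureReal_restrict_apply measurableSet_Icc,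
      measureReal_restrict_apply measurableSet_Ioc,
      Set.inter_eq_left.2 hsubA, Set.inter_eq_left.2 hsubB,
      Real.volume_real_Icc_of_le (by linarith), Real.volume_real_Ioc_of_le (by linarith)]
    simp only [smul_eq_mul]
    ring
  refine ⟨hnorm, ?_, fun f hf => tendsto_integral_abs_sub_sub_integral_abs hf hint ?_⟩
  · simp only [hnorm]
    refine tendsto_atTop_mono' _ ?_ tendsto_natCast_atTop_atTop
    filter_upwards [eventually_ge_atTop 1] with n hn
    have hn' : (1 : ℝ) ≤ n := by exact_mod_cast hn
    rw [le_div_iff₀ (by positivity)]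
    nlinarith
  · have hne : ∀ᵐ ω ∂μ01, ω ≠ 1 / 2 :=
      ae_restrict_of_ae (Measure.ae_ne volume (1 / 2))
    filter_upwards [hne] with ω hω
    have hpos : 0 < |ω - 1 / 2| := abs_pos.2 (sub_ne_zero.2 hω)
    filter_upwards [(tendsto_one_div_add_atTop_nhds_zero_nat (𝕜 := ℝ)).eventually_lt_const hpos]
      with n hn
    have hnA : ω ∉ A n := by
      rw [hA]
      rintro ⟨h₁, h₂⟩
      rw [abs_of_nonpos (by linarith)] at hn
      linarith
    have hnB : ω ∉ B n := by
      rw [hB]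
      rintro ⟨h₁, h₂⟩
      rw [abs_of_pos (by linarith)] at hn
      linarith
    simp [hg, hnA, hnB]
end

section
/- Let A be a measurable subset of Ω with ℙ(A) > 0, let g ∈ L_1(Ω,ℙ), and for n ∈ ℕ define g_n = n·1_A + g·1_{Ω∖A}. Then ‖g_n‖_{L_1} = n·ℙ(A) + E[1_{Ω∖A}|g|] → ∞ as n → ∞, and for every f ∈ L_1(Ω,ℙ) one has ‖f − g_n‖_{L_1} − ‖g_n‖_{L_1} → E[−1_A f] + E[1_{Ω∖A}(|f−g| − |g|)] as n → ∞. -/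
open MeasureTheory Filter Topology

/-- The metric functionals of the constants `n` converge pointwise to `f ↦ -∫ f` on `L₁` of a
finite measure. -/
theorem tendsto_integral_abs_sub_natCast_sub {Ω : Type*} [MeasurableSpace Ω] {ν : Measure Ω}
    [IsFiniteMeasure ν] {f : Ω → ℝ} (hf : Integrable f ν) :
    Tendsto (fun n : ℕ => ∫ ω, (|f ω - n| - n) ∂ν) atTop (𝓝 (∫ ω, -f ω ∂ν)) := by
  refine tendsto_integral_of_dominated_convergence (fun ω => |f ω|)
    (fun n => ((hf.sub (integrable_const _)).abs.sub
      (integrable_const _)).aestronglyMeasurable) hf.abs (fun n => ?_) ?_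
  · filter_upwards with ω
    have h := abs_abs_sub_abs_le (f ω - n) (-n)
    rwa [abs_neg, Nat.abs_cast, sub_neg_eq_add, sub_add_cancel] at h
  · filter_upwards with ω
    refine tendsto_const_nhds.congr' ?_
    filter_upwards [eventually_ge_atTop ⌈f ω⌉₊] with n hn
    rw [abs_of_nonpos (sub_nonpos.2 (Nat.ceil_le.1 hn))]
    ring

/-- With `A ⊆ Ω` of positive measure, `g ∈ L₁` and `gₙ = n·1_A + g·1_{Ω∖A}`, the norms
`‖gₙ‖_{L₁} = n·ℙ(A) + E[1_{Ω∖A}|g|]` tend to infinity, and the internal metric functionals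
`h_{gₙ}` converge pointwise on `L₁` to
`f ↦ E[−1_A f] + E[1_{Ω∖A}(|f−g| − |g|)]`. -/
theorem sequence_escaping_on_a_set_of_positive_measure
    {Ω : Type*} [MeasurableSpace Ω] (μ : Measure Ω) [IsProbabilityMeasure μ]
    (A : Set Ω) (hAm : MeasurableSet A) (hA : 0 < μ A)
    (g : Ω → ℝ) (hg : Integrable g μ)
    (gseq : ℕ → Ω → ℝ)
    (hgseq : ∀ n, gseq n = fun ω =>
      A.indicator (fun _ => (n : ℝ)) ω + Aᶜ.indicator g ω) :
    (∀ n, ∫ ω, |gseq n ω| ∂μ = n * (μ A).toReal + ∫ ω in Aᶜ, |g ω| ∂μ) ∧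
    Tendsto (fun n => ∫ ω, |gseq n ω| ∂μ) atTop atTop ∧
    ∀ f : Ω → ℝ, Integrable f μ →
      Tendsto (fun n => (∫ ω, |f ω - gseq n ω| ∂μ) - ∫ ω, |gseq n ω| ∂μ) atTop
        (𝓝 ((∫ ω in A, -f ω ∂μ) + ∫ ω in Aᶜ, (|f ω - g ω| - |g ω|) ∂μ)) := by
  have hgA : ∀ n, ∀ ω ∈ A, gseq n ω = n := fun n ω hω => by simp [hgseq, hω]
  have hgAc : ∀ n, ∀ ω ∈ Aᶜ, gseq n ω = g ω := fun n ω hω => by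
    have hω' : ω ∉ A := hω
    simp [hgseq, hω']
  have hint : ∀ n, Integrable (gseq n) μ := fun n => by
    rw [hgseq]
    exact ((integrable_const _).indicator hAm).add (hg.indicator hAm.compl)
  have hnorm : ∀ n, ∫ ω, |gseq n ω| ∂μ = n * (μ A).toReal + ∫ ω in Aᶜ, |g ω| ∂μ := fun n => by
    rw [← integral_add_compl hAm (hint n).abs]
    congr 1
    · rw [setIntegral_congr_fun hAm (g := fun _ => (n : ℝ)) fun ω hω => by simp [hgA n ω hω]]
      simp [Measure.real, mul_comm]
    · exact setIntegral_congr_fun hAm.compl fun ω hω => by simp only [hgAc n ω hω]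
  refine ⟨hnorm, ?_, fun f hf => ?_⟩
  · simp only [hnorm]
    exact tendsto_atTop_add_const_right _ _ (tendsto_natCast_atTop_atTop.atTop_mul_const
      (ENNReal.toReal_pos hA.ne' (measure_ne_top μ A)))
  · refine ((tendsto_integral_abs_sub_natCast_sub hf.integrableOn).add_const _).congr fun n => ?_
    have hd : Integrable (fun ω => |f ω - gseq n ω|) μ := (hf.sub (hint n)).abs
    have hdiff : Integrable (fun ω => |f ω - gseq n ω| - |gseq n ω|) μ := hd.sub (hint n).abs
    rw [← integral_sub hd (hint n).abs, ← integral_add_compl hAm hdiff]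
    congr 1
    · exact setIntegral_congr_fun hAm fun ω hω => by simp [hgA n ω hω]
    · exact setIntegral_congr_fun hAm.compl fun ω hω => by simp only [hgAc n ω hω]
end

section
/- Let Ω = [0,1] with Lebesgue measure, and let g_n(ω) = sgn(sin(2ⁿ π ω)) be the n-th Rademacher function. Then for every f ∈ L_1([0,1]), ‖f − g_n‖_{L_1} − ‖g_n‖_{L_1} → E[ (1/2)(|f+1| − 1) + (1/2)(|f−1| − 1) ] as n → ∞. -/
open MeasureTheory Filter Topology Real

/-- Translation is continuous in `L¹(ℝ)`. -/
theorem tendsto_integral_abs_sub_translate {F : ℝ → ℝ} (hF : Integrable F) :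
    Tendsto (fun h : ℝ => ∫ x, |F (h + x) - F x|) (𝓝 0) (𝓝 0) := by
  have : Fact ((1 : ENNReal) ≠ ⊤) := ⟨ENNReal.one_ne_top⟩
  have hm : MemLp F 1 volume := memLp_one_iff_integrable.2 hF
  have hc : Continuous fun h : ℝ => dist (DomAddAct.mk h +ᵥ hm.toLp F) (hm.toLp F) :=
    (DomAddAct.continuous_mk.vadd continuous_const).dist continuous_const
  have h0 := hc.tendsto 0
  have hz : dist (DomAddAct.mk (0 : ℝ) +ᵥ hm.toLp F) (hm.toLp F) = 0 := by simp
  rw [hz] at h0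
  refine h0.congr fun h => ?_
  rw [DomAddAct.mk_vadd_toLp, dist_eq_norm, ← MemLp.toLp_sub, L1.norm_eq_integral_norm]
  refine integral_congr_ae ?_
  filter_upwards [MemLp.coeFn_toLp ((hm.comp_measurePreserving
    (measurePreserving_vadd h volume)).sub hm)] with x hx
  exact congrArg norm hx

theorem measurable_real_sign : Measurable Real.sign :=
  Measurable.ite measurableSet_Iio measurable_const
    (Measurable.ite measurableSet_Ioi measurable_const measurable_const)

theorem abs_real_sign_le_one (x : ℝ) : |Real.sign x| ≤ 1 := by
  rcases Real.sign_apply_eq x with h | h | h <;> simp [h]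

/-- The `n`-th Rademacher function, extended periodically to `ℝ`. -/
noncomputable def rademacher (n : ℕ) (ω : ℝ) : ℝ := Real.sign (Real.sin (2 ^ n * π * ω))

theorem measurable_rademacher (n : ℕ) : Measurable (rademacher n) :=
  measurable_real_sign.comp (by fun_prop)

theorem abs_rademacher_le_one (n : ℕ) (ω : ℝ) : |rademacher n ω| ≤ 1 :=
  abs_real_sign_le_one _

/-- Translating a Rademacher function by half a period changes its sign. -/
theorem rademacher_half_period_add (n : ℕ) (ω : ℝ) :
    rademacher n ((2 ^ n)⁻¹ + ω) = -rademacher n ω := by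
  have h : (2 : ℝ) ^ n * π * ((2 ^ n)⁻¹ + ω) = 2 ^ n * π * ω + π := by
    field_simp
    ring
  rw [rademacher, h, Real.sin_add_pi, Real.sign_neg, rademacher]

theorem rademacher_eq_neg_one_or_one_ae (n : ℕ) :
    ∀ᵐ ω : ℝ, rademacher n ω = -1 ∨ rademacher n ω = 1 := by
  have hc : (Set.range fun k : ℤ => (k : ℝ) / 2 ^ n).Countable := Set.countable_range _
  filter_upwards [hc.ae_notMem volume] with ω hω
  refine Real.sign_apply_eq_of_ne_zero _ fun h => hω ?_
  obtain ⟨k, hk⟩ := Real.sin_eq_zero_iff.1 h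
  refine ⟨k, ?_⟩
  have hk' : (k : ℝ) = 2 ^ n * ω :=
    mul_right_cancel₀ Real.pi_ne_zero (hk.trans (by ring))
  simp [hk']

theorem MeasureTheory.Integrable.mul_rademacher {μ : Measure ℝ} {F : ℝ → ℝ}
    (hF : Integrable F μ) (n : ℕ) : Integrable (fun x => F x * rademacher n x) μ :=
  hF.mul_bdd (c := 1) (measurable_rademacher n).aestronglyMeasurable
    (Eventually.of_forall fun x => abs_rademacher_le_one n x)

theorem abs_integral_mul_rademacher_le {F : ℝ → ℝ} (hF : Integrable F) (n : ℕ) :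
    |∫ x, F x * rademacher n x| ≤ ∫ x, |F ((2 ^ n)⁻¹ + x) - F x| := by
  have hT : Integrable fun x => F ((2 ^ n)⁻¹ + x) := hF.comp_add_left _
  have hshift : ∫ x, F ((2 ^ n)⁻¹ + x) * rademacher n x = -∫ x, F x * rademacher n x := by
    rw [← integral_add_left_eq_self (fun x => F x * rademacher n x) ((2 ^ n)⁻¹ : ℝ),
      ← integral_neg]
    simp_rw [rademacher_half_period_add, mul_neg, neg_neg]
  have hsub : ∫ x, (F ((2 ^ n)⁻¹ + x) - F x) * rademacher n x
      = -(2 * ∫ x, F x * rademacher n x) := by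
    simp_rw [sub_mul]
    rw [integral_sub (hT.mul_rademacher n) (hF.mul_rademacher n), hshift]
    ring
  have hle : |∫ x, (F ((2 ^ n)⁻¹ + x) - F x) * rademacher n x|
      ≤ ∫ x, |F ((2 ^ n)⁻¹ + x) - F x| := by
    refine abs_integral_le_integral_abs.trans
      (integral_mono ((hT.sub hF).mul_rademacher n).abs (hT.sub hF).abs fun x => ?_)
    simp only [abs_mul]
    exact mul_le_of_le_one_right (abs_nonneg _) (abs_rademacher_le_one n x)
  rw [hsub, abs_neg, abs_mul, abs_two] at hle
  linarith [abs_nonneg (∫ x, F x * rademacher n x)]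

/-- A Riemann–Lebesgue lemma for the Rademacher functions. -/
theorem tendsto_integral_mul_rademacher {F : ℝ → ℝ} (hF : Integrable F) :
    Tendsto (fun n => ∫ x, F x * rademacher n x) atTop (𝓝 0) := by
  have hs : Tendsto (fun n : ℕ => ((2 : ℝ) ^ n)⁻¹) atTop (𝓝 0) :=
    tendsto_inv_atTop_zero.comp (tendsto_pow_atTop_atTop_of_one_lt one_lt_two)
  exact squeeze_zero_norm (fun n => abs_integral_mul_rademacher_le hF n)
    ((tendsto_integral_abs_sub_translate hF).comp hs)

theorem tendsto_setIntegral_mul_rademacher {s : Set ℝ} (hs : MeasurableSet s) {F : ℝ → ℝ}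
    (hF : IntegrableOn F s) :
    Tendsto (fun n => ∫ x in s, F x * rademacher n x) atTop (𝓝 0) := by
  refine (tendsto_integral_mul_rademacher (hF.integrable_indicator hs)).congr fun n => ?_
  rw [← integral_indicator hs]
  simp_rw [Set.indicator_mul_left]

/-- For the Rademacher sequence `gₙ(ω) = sgn(sin(2ⁿπω))` on `[0,1]`, the internal metric
functionals `h_{gₙ}` converge pointwise on `L₁([0,1])` to
`f ↦ E[(1/2)(|f+1| − 1) + (1/2)(|f−1| − 1)]`. -/
theorem rademacher_internal_functionals_converge
    (g : ℕ → ℝ → ℝ)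
    (hg : ∀ n, g n = fun ω => Real.sign (Real.sin (2 ^ n * π * ω))) :
    ∀ f : ℝ → ℝ, Integrable f μ01 →
      Tendsto (fun n => (∫ ω, |f ω - g n ω| ∂μ01) - ∫ ω, |g n ω| ∂μ01) atTop
        (𝓝 (∫ ω, ((1 / 2) * (|f ω + 1| - 1) + (1 / 2) * (|f ω - 1| - 1)) ∂μ01)) := by
  intro f hf
  obtain rfl : g = rademacher := funext hg
  have : IsFiniteMeasure μ01 := by
    unfold μ01
    infer_instance
  have hp : Integrable (fun ω => |f ω + 1|) μ01 := (hf.add (integrable_const 1)).abs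
  have hm : Integrable (fun ω => |f ω - 1|) μ01 := (hf.sub (integrable_const 1)).abs
  have hG : Integrable (fun ω => (1 / 2) * (|f ω + 1| - 1) + (1 / 2) * (|f ω - 1| - 1)) μ01 :=
    ((hp.sub (integrable_const 1)).const_mul _).add ((hm.sub (integrable_const 1)).const_mul _)
  have hF : Integrable (fun ω => (1 / 2) * (|f ω - 1| - |f ω + 1|)) μ01 :=
    (hm.sub hp).const_mul _
  have hr (n : ℕ) : Integrable (rademacher n) μ01 := by
    simpa using (integrable_const (1 : ℝ)).mul_rademacher (μ := μ01) n
  have hlim := (tendsto_setIntegral_mul_rademacher measurableSet_Icc hF).const_add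
    (∫ ω, ((1 / 2) * (|f ω + 1| - 1) + (1 / 2) * (|f ω - 1| - 1)) ∂μ01)
  rw [add_zero] at hlim
  refine hlim.congr fun n => ?_
  have hd : Integrable (fun ω => |f ω - rademacher n ω|) μ01 := (hf.sub (hr n)).abs
  change _ + ∫ ω, _ ∂μ01 = _
  rw [← integral_add hG (hF.mul_rademacher n), ← integral_sub hd (hr n).abs]
  refine integral_congr_ae ?_
  filter_upwards [ae_restrict_of_ae (rademacher_eq_neg_one_or_one_ae n)] with ω hω
  rcases hω with h | h <;> simp only [h, sub_neg_eq_add, abs_neg, abs_one] <;> ring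
end

section
/- L_p-mean ergodic theorem: let 1 < p < ∞, let (Ω,ℙ) be a probability space, let T : L_p → L_p be a linear operator with ‖Tf‖_p ≤ ‖f‖_p for all f ∈ L_p, and let g ∈ L_p. Then the limit τ = lim_{n→∞} (1/n)‖∑_{k=0}^{n−1} T^k g‖_p exists, and there exists h ∈ L_p with ‖h‖_p = τ such that (1/n)∑_{k=0}^{n−1} T^k g → h in L_p-norm as n → ∞ (in particular, if τ > 0 then h = τ g* for a unit vector g* ∈ L_p, and if τ = 0 then h = 0). -/
open MeasureTheory Filter Topology

/-- Strict midpoint convexity of `x ↦ |x| ^ p` for `1 < p`. -/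
lemma abs_half_add_rpow_lt {p : ℝ} (hp : 1 < p) {a b : ℝ} (hab : a ≠ b) :
    |(a + b) / 2| ^ p < (|a| ^ p + |b| ^ p) / 2 := by
  have hp0 : 0 < p := by linarith
  by_cases h : |a| = |b|
  · have hba : b = -a := by
      rcases abs_eq_abs.1 h with h | h
      · exact absurd h hab
      · linarith
    have ha : a ≠ 0 := by
      rintro rfl
      simp [hba] at hab
    have := Real.rpow_pos_of_pos (abs_pos.2 ha) p
    simpa [hba, Real.zero_rpow hp0.ne'] using this
  · have hconv := (strictConvexOn_rpow hp).2 (abs_nonneg a) (abs_nonneg b) h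
      (by norm_num : (0 : ℝ) < 1 / 2) (by norm_num : (0 : ℝ) < 1 / 2) (by norm_num)
    simp only [smul_eq_mul] at hconv
    have hle : |(a + b) / 2| ≤ 1 / 2 * |a| + 1 / 2 * |b| := by
      rw [abs_div, abs_two]
      linarith [abs_add_le a b]
    have := Real.rpow_le_rpow (abs_nonneg _) hle hp0.le
    linarith

/-- Midpoint convexity of `x ↦ |x| ^ p` for `1 < p`. -/
lemma abs_half_add_rpow_le {p : ℝ} (hp : 1 < p) (a b : ℝ) :
    |(a + b) / 2| ^ p ≤ (|a| ^ p + |b| ^ p) / 2 := by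
  rcases eq_or_ne a b with rfl | hab
  · simp
  · exact (abs_half_add_rpow_lt hp hab).le

/-- Up to a small multiple of `|a| ^ p + |b| ^ p`, the quantity `|a - b| ^ p` is controlled by the
midpoint convexity defect of `x ↦ |x| ^ p`. -/
lemma exists_abs_sub_rpow_le {p : ℝ} (hp : 1 < p) {ε : ℝ} (hε : 0 < ε) :
    ∃ C : ℝ, 0 < C ∧ ∀ a b : ℝ, |a - b| ^ p ≤
      ε * (|a| ^ p + |b| ^ p) + C * ((|a| ^ p + |b| ^ p) / 2 - |(a + b) / 2| ^ p) := by
  have hp0 : 0 < p := by linarith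
  let F : ℝ × ℝ → ℝ := fun x ↦ |x.1 - x.2| ^ p
  let G : ℝ × ℝ → ℝ := fun x ↦ (|x.1| ^ p + |x.2| ^ p) / 2 - |(x.1 + x.2) / 2| ^ p
  have hF : Continuous F := (by fun_prop : Continuous fun x : ℝ × ℝ ↦ |x.1 - x.2|).rpow_const
    fun _ ↦ Or.inr hp0.le
  have hG : Continuous G :=
    ((((by fun_prop : Continuous fun x : ℝ × ℝ ↦ |x.1|).rpow_const fun _ ↦ Or.inr hp0.le).add
      ((by fun_prop : Continuous fun x : ℝ × ℝ ↦ |x.2|).rpow_const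
        fun _ ↦ Or.inr hp0.le)).div_const 2).sub
      ((by fun_prop : Continuous fun x : ℝ × ℝ ↦ |(x.1 + x.2) / 2|).rpow_const
        fun _ ↦ Or.inr hp0.le)
  have hK : IsCompact (Metric.sphere (0 : ℝ × ℝ) 1 ∩ {x | ε ≤ F x}) :=
    (isCompact_sphere _ _).inter_right (isClosed_le continuous_const hF)
  obtain ⟨δ, hδ, hGδ⟩ := hK.exists_forall_le' hG.continuousOn (a := 0) (by
    rintro ⟨a, b⟩ ⟨-, hx⟩
    refine sub_pos.2 (abs_half_add_rpow_lt hp ?_)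
    intro (hab : a = b)
    have : ε ≤ |a - b| ^ p := hx
    rw [hab, sub_self, abs_zero, Real.zero_rpow hp0.ne'] at this
    linarith)
  have hsphere : ∀ x ∈ Metric.sphere (0 : ℝ × ℝ) 1, F x ≤ ε + 2 ^ p / δ * G x := by
    rintro ⟨a, b⟩ hx
    have hGnonneg : 0 ≤ G (a, b) := sub_nonneg.2 (abs_half_add_rpow_le hp a b)
    by_cases hεF : ε ≤ F (a, b)
    · have hFle : F (a, b) ≤ 2 ^ p := by
        refine Real.rpow_le_rpow (abs_nonneg _) ?_ hp0.le
        have h1 : ‖(a, b)‖ = 1 := by simpa using hx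
        have ha : |a| ≤ 1 := h1 ▸ norm_fst_le (a, b)
        have hb : |b| ≤ 1 := h1 ▸ norm_snd_le (a, b)
        linarith [abs_sub a b]
      have : 2 ^ p / δ * δ ≤ 2 ^ p / δ * G (a, b) :=
        mul_le_mul_of_nonneg_left (hGδ _ ⟨hx, hεF⟩) (by positivity)
      rw [div_mul_cancel₀ _ hδ.ne'] at this
      linarith
    · have : 0 ≤ 2 ^ p / δ * G (a, b) := by positivity
      linarith
  refine ⟨2 ^ p / δ, by positivity, fun a b ↦ ?_⟩
  rcases eq_or_ne (a, b) 0 with h0 | h0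
  · obtain ⟨rfl, rfl⟩ := Prod.mk_eq_zero.1 h0
    simp [Real.zero_rpow hp0.ne']
  set r := ‖(a, b)‖ with hr
  have hr0 : 0 < r := norm_pos_iff.2 h0
  have hscale : ∀ t : ℝ, |t / r| ^ p = |t| ^ p / r ^ p := fun t ↦ by
    rw [abs_div, abs_of_pos hr0, Real.div_rpow (abs_nonneg _) hr0.le]
  have hunit := hsphere (a / r, b / r) (by
    have : (a / r, b / r) = r⁻¹ • (a, b) := by simp [div_eq_inv_mul]
    rw [mem_sphere_zero_iff_norm, this, norm_smul, norm_inv, Real.norm_of_nonneg hr0.le, ← hr,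
      inv_mul_cancel₀ hr0.ne'])
  have hrp : r ^ p ≤ |a| ^ p + |b| ^ p := by
    have ha := Real.rpow_nonneg (abs_nonneg a) p
    have hb := Real.rpow_nonneg (abs_nonneg b) p
    rcases max_choice |a| |b| with h | h
    · rw [show r = |a| from h]; linarith
    · rw [show r = |b| from h]; linarith
  have hrp0 : 0 < r ^ p := Real.rpow_pos_of_pos hr0 p
  have hmid : (a / r + b / r) / 2 = (a + b) / 2 / r := by ring
  simp only [F, G] at hunit
  rw [← sub_div, hmid, hscale, hscale, hscale, hscale] at hunit
  have := mul_le_mul_of_nonneg_right hunit hrp0.le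
  rw [div_mul_cancel₀ _ hrp0.ne'] at this
  calc |a - b| ^ p ≤ _ := this
    _ = ε * r ^ p + 2 ^ p / δ * ((|a| ^ p + |b| ^ p) / 2 - |(a + b) / 2| ^ p) := by
      field_simp
    _ ≤ _ := by gcongr

section Lp

variable {Ω : Type*} [MeasurableSpace Ω] {μ : Measure Ω} {p : ENNReal}

lemma MeasureTheory.Lp.norm_rpow_toReal_eq_integral (hp0 : p ≠ 0) (hp : p ≠ ⊤) (f : Lp ℝ p μ) :
    ‖f‖ ^ p.toReal = ∫ x, |f x| ^ p.toReal ∂μ := by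
  have hnonneg : 0 ≤ ∫ x, |f x| ^ p.toReal ∂μ := integral_nonneg fun x ↦ by positivity
  rw [Lp.norm_def, (Lp.memLp f).eLpNorm_eq_integral_rpow_norm hp0 hp]
  simp only [Real.norm_eq_abs]
  rw [ENNReal.toReal_ofReal (by positivity),
    Real.rpow_inv_rpow hnonneg (ENNReal.toReal_pos hp0 hp).ne']

lemma MeasureTheory.Lp.integrable_abs_rpow (hp0 : p ≠ 0) (hp : p ≠ ⊤) (f : Lp ℝ p μ) :
    Integrable (fun x ↦ |f x| ^ p.toReal) μ :=
  (Lp.memLp f).integrable_norm_rpow hp0 hp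

lemma MeasureTheory.Lp.exists_norm_sub_rpow_le [Fact (1 ≤ p)] (hp1 : 1 < p) (hp : p ≠ ⊤) {ε : ℝ}
    (hε : 0 < ε) :
    ∃ C : ℝ, 0 < C ∧ ∀ f g : Lp ℝ p μ, ‖f - g‖ ^ p.toReal ≤
      ε * (‖f‖ ^ p.toReal + ‖g‖ ^ p.toReal) +
        C * ((‖f‖ ^ p.toReal + ‖g‖ ^ p.toReal) / 2 - ‖(2⁻¹ : ℝ) • (f + g)‖ ^ p.toReal) := by
  have hp0 : p ≠ 0 := (zero_lt_one.trans hp1).ne'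
  have hp1' : 1 < p.toReal := by
    simpa using (ENNReal.toReal_lt_toReal ENNReal.one_ne_top hp).2 hp1
  obtain ⟨C, hC, hle⟩ := exists_abs_sub_rpow_le hp1' hε
  refine ⟨C, hC, fun f g ↦ ?_⟩
  have hint := Lp.integrable_abs_rpow (μ := μ) hp0 hp
  have hfg : Integrable (fun x ↦ |f x| ^ p.toReal + |g x| ^ p.toReal) μ := (hint f).add (hint g)
  have hdefect : Integrable (fun x ↦ (|f x| ^ p.toReal + |g x| ^ p.toReal) / 2 -
      |((2⁻¹ : ℝ) • (f + g) : Lp ℝ p μ) x| ^ p.toReal) μ := (hfg.div_const 2).sub (hint _)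
  simp only [Lp.norm_rpow_toReal_eq_integral hp0 hp]
  rw [← integral_add (hint f) (hint g), ← integral_div, ← integral_sub (hfg.div_const 2) (hint _),
    ← integral_const_mul, ← integral_const_mul,
    ← integral_add (hfg.const_mul ε) (hdefect.const_mul C)]
  refine integral_mono_ae (hint _) ((hfg.const_mul ε).add (hdefect.const_mul C)) ?_
  filter_upwards [Lp.coeFn_sub f g, Lp.coeFn_smul (2⁻¹ : ℝ) (f + g), Lp.coeFn_add f g]
    with x hsub hsmul hadd
  have hmid : ((2⁻¹ : ℝ) • (f + g) : Lp ℝ p μ) x = (f x + g x) / 2 := by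
    rw [hsmul, Pi.smul_apply, hadd, Pi.add_apply, smul_eq_mul, inv_mul_eq_div]
  simp only [hsub, hmid, Pi.sub_apply]
  exact hle (f x) (g x)

/-- `L_p` is uniformly convex for `1 < p < ∞`. -/
theorem MeasureTheory.Lp.uniformConvexSpace [Fact (1 ≤ p)] (hp1 : 1 < p) (hp : p ≠ ⊤) :
    UniformConvexSpace (Lp ℝ p μ) := by
  refine ⟨fun ε hε ↦ ?_⟩
  have hq : 0 < p.toReal := ENNReal.toReal_pos (zero_lt_one.trans hp1).ne' hp
  have hεp : 0 < ε ^ p.toReal := Real.rpow_pos_of_pos hε _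
  obtain ⟨C, hC, hle⟩ := Lp.exists_norm_sub_rpow_le (μ := μ) hp1 hp
    (by positivity : 0 < ε ^ p.toReal / 4)
  set θ := ε ^ p.toReal / (2 * C) with hθ
  have hθ0 : 0 < θ := by positivity
  set s := (max 0 (1 - θ)) ^ p.toReal⁻¹
  have hs : s < 1 := Real.rpow_lt_one (le_max_left _ _) (max_lt one_pos (by linarith))
    (inv_pos.2 hq)
  refine ⟨2 - 2 * s, by linarith, fun f hf g hg hfg ↦ ?_⟩
  have hfg' := hle f g
  rw [hf, hg, Real.one_rpow] at hfg'
  have hε' : ε ^ p.toReal ≤ ‖f - g‖ ^ p.toReal := Real.rpow_le_rpow hε.le hfg hq.le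
  have hmid : ‖(2⁻¹ : ℝ) • (f + g)‖ ^ p.toReal ≤ max 0 (1 - θ) := by
    refine le_max_of_le_right ?_
    have hCθ : C * θ = ε ^ p.toReal / 2 := by rw [hθ]; field_simp
    refine le_of_mul_le_mul_left ?_ hC
    linarith
  have hle_s := (Real.le_rpow_inv_iff_of_pos (norm_nonneg _) (le_max_left _ _) hq).2 hmid
  rw [norm_smul, norm_inv, Real.norm_two] at hle_s
  change 2⁻¹ * ‖f + g‖ ≤ s at hle_s
  linarith

end Lp

section UniformConvex

variable {E : Type*} [NormedAddCommGroup E] [NormedSpace ℝ E] [UniformConvexSpace E]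

/-- In a uniformly convex space, points of a convex set which are almost of minimal norm are
close to each other. -/
lemma Convex.exists_forall_norm_sub_lt {K : Set E} (hK : Convex ℝ K) {d : ℝ} (hd : 0 ≤ d)
    (hKd : ∀ x ∈ K, d ≤ ‖x‖) {ε : ℝ} (hε : 0 < ε) :
    ∃ η, 0 < η ∧ ∀ x ∈ K, ∀ y ∈ K, ‖x‖ ≤ d + η → ‖y‖ ≤ d + η → ‖x - y‖ < ε := by
  obtain ⟨δ, hδ, hball⟩ := exists_forall_closed_ball_dist_add_le_two_mul_sub E (half_pos hε) d
  set η := min (ε / 4) (δ / 4)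
  have hη : 0 < η := by positivity
  refine ⟨η, hη, fun x hx y hy hxη hyη ↦ ?_⟩
  by_contra! hxy
  have hdη : 0 < d + η := by linarith
  set c := d / (d + η) with hc
  have hc0 : 0 ≤ c := by positivity
  have hcd : c * (d + η) = d := div_mul_cancel₀ _ hdη.ne'
  have hc1 : 0 ≤ 1 - c := by
    rw [hc, sub_nonneg, div_le_one hdη]
    linarith
  have hshrink : ∀ z : E, ‖z‖ ≤ d + η → ‖c • z‖ ≤ d ∧ ‖z - c • z‖ ≤ η := fun z hz ↦ by
    constructor
    · rw [norm_smul, Real.norm_of_nonneg hc0, ← hcd]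
      gcongr
    · rw [show z - c • z = (1 - c) • z by module, norm_smul, Real.norm_of_nonneg hc1]
      nlinarith [mul_le_mul_of_nonneg_left hz hc1]
  obtain ⟨hx1, hx2⟩ := hshrink x hxη
  obtain ⟨hy1, hy2⟩ := hshrink y hyη
  have hsub : ‖x - y‖ ≤ ‖c • x - c • y‖ + η + η := by
    rw [show x - y = (c • x - c • y) + (x - c • x) - (y - c • y) by module]
    exact (norm_sub_le _ _).trans (add_le_add ((norm_add_le _ _).trans (by gcongr)) hy2)
  have hadd : ‖x + y‖ ≤ ‖c • x + c • y‖ + η + η := by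
    rw [show x + y = (c • x + c • y) + (x - c • x) + (y - c • y) by module]
    exact (norm_add_le _ _).trans (add_le_add ((norm_add_le _ _).trans (by gcongr)) hy2)
  have hηε : η ≤ ε / 4 := min_le_left _ _
  have hηδ : η ≤ δ / 4 := min_le_right _ _
  have hsmall := hball hx1 hy1 (by linarith)
  have hmid := hKd _ (hK hx hy (by norm_num : (0 : ℝ) ≤ 1 / 2) (by norm_num : (0 : ℝ) ≤ 1 / 2)
    (by norm_num))
  rw [← smul_add, norm_smul, Real.norm_of_nonneg (by norm_num)] at hmid
  linarith

/-- A nonempty closed convex subset of a uniformly convex Banach space has a unique element of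
minimal norm. -/
theorem Convex.exists_unique_minimal_norm [CompleteSpace E] {K : Set E} (hK : Convex ℝ K)
    (hcl : IsClosed K) (hne : K.Nonempty) :
    ∃ h ∈ K, ∀ x ∈ K, ‖x‖ ≤ ‖h‖ → x = h := by
  set d := sInf (norm '' K)
  have hbdd : BddBelow (norm '' K) := ⟨0, by rintro _ ⟨x, -, rfl⟩; exact norm_nonneg x⟩
  have hd : 0 ≤ d := Real.sInf_nonneg (by rintro _ ⟨x, -, rfl⟩; exact norm_nonneg x)
  have hKd : ∀ x ∈ K, d ≤ ‖x‖ := fun x hx ↦ csInf_le hbdd (Set.mem_image_of_mem _ hx)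
  have hclose := fun (ε : ℝ) (hε : 0 < ε) ↦ hK.exists_forall_norm_sub_lt hd hKd hε
  obtain ⟨v, -, hv, hvK⟩ := exists_seq_tendsto_sInf (hne.image norm) hbdd
  choose u huK huv using hvK
  have hu : Tendsto (fun n ↦ ‖u n‖) atTop (𝓝 d) := by simpa only [huv] using hv
  have hcauchy : CauchySeq u := by
    refine Metric.cauchySeq_iff.2 fun ε hε ↦ ?_
    obtain ⟨η, hη, hηε⟩ := hclose ε hε
    obtain ⟨N, hN⟩ := eventually_atTop.1 (hu.eventually_le_const (lt_add_of_pos_right d hη))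
    refine ⟨N, fun m hm n hn ↦ ?_⟩
    rw [dist_eq_norm]
    exact hηε _ (huK m) _ (huK n) (hN m hm) (hN n hn)
  obtain ⟨h, hh⟩ := cauchySeq_tendsto_of_complete hcauchy
  have hhK : h ∈ K := hcl.mem_of_tendsto hh (Eventually.of_forall huK)
  have hhd : ‖h‖ = d := tendsto_nhds_unique hh.norm hu
  refine ⟨h, hhK, fun x hx hxh ↦ ?_⟩
  by_contra hne'
  obtain ⟨η, hη, hηε⟩ := hclose ‖x - h‖ (norm_pos_iff.2 (sub_ne_zero.2 hne'))
  exact lt_irrefl _ (hηε x hx h hhK (by linarith) (by linarith))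

/-- **Mean ergodic theorem** for a linear contraction of a uniformly convex Banach space. -/
theorem LinearMap.exists_tendsto_birkhoffAverage [CompleteSpace E] (T : E →ₗ[ℝ] E)
    (hT : ∀ x, ‖T x‖ ≤ ‖x‖) (g : E) :
    ∃ h, Tendsto (birkhoffAverage ℝ T _root_.id · g) atTop (𝓝 h) := by
  have hlip : LipschitzWith 1 T := LipschitzWith.of_dist_le_mul fun x y ↦ by
    simpa [dist_eq_norm] using hT (x - y)
  have hlin : ∀ (a b : ℝ) (x y : E) (n : ℕ), birkhoffAverage ℝ T _root_.id n (a • x + b • y) =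
      a • birkhoffAverage ℝ T _root_.id n x + b • birkhoffAverage ℝ T _root_.id n y := fun a b x y n ↦ by
    simp only [birkhoffAverage, birkhoffSum, _root_.id, ← Module.End.pow_apply, map_add, map_smul,
      Finset.sum_add_distrib, ← Finset.smul_sum]
    module
  have hcomb : ∀ (a b : ℝ) {x y u v : E}, Tendsto (birkhoffAverage ℝ T _root_.id · x) atTop (𝓝 u) →
      Tendsto (birkhoffAverage ℝ T _root_.id · y) atTop (𝓝 v) →
      Tendsto (birkhoffAverage ℝ T _root_.id · (a • x + b • y)) atTop (𝓝 (a • u + b • v)) :=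
    fun a b {x y u v} hx hy ↦ by
      simpa only [hlin] using (hx.const_smul a).add (hy.const_smul b)
  let N : Set E := {x | Tendsto (birkhoffAverage ℝ T _root_.id · x) atTop (𝓝 0)}
  have hNcl : IsClosed N :=
    isClosed_setOfPred_tendsto_birkhoffAverage ℝ hlip uniformContinuous_id continuous_const
  have hNcomb : ∀ (a b : ℝ) {x y : E}, x ∈ N → y ∈ N → a • x + b • y ∈ N :=
    fun a b {x y} hx hy ↦ by simpa [N] using hcomb a b hx hy
  have hNsub : ∀ x, T x - x ∈ N := fun x ↦ by
    have hbdd : Bornology.IsBounded (Set.range fun n ↦ _root_.id (T^[n] x)) := by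
      refine isBounded_iff_forall_norm_le.2 ⟨‖x‖, Set.forall_mem_range.2 fun n ↦ ?_⟩
      induction n with
      | zero => simp
      | succ n ih =>
        rw [_root_.id, Function.iterate_succ_apply']
        exact (hT _).trans ih
    have := tendsto_birkhoffAverage_apply_sub_birkhoffAverage ℝ hbdd
    have hdiff : ∀ n, birkhoffAverage ℝ T _root_.id n (T x - x) =
        birkhoffAverage ℝ T _root_.id n (T x) - birkhoffAverage ℝ T _root_.id n x := fun n ↦ by
      simpa [sub_eq_add_neg] using hlin 1 (-1) (T x) x n
    simpa only [N, Set.mem_ofPred_eq, hdiff] using this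
  let K : Set E := {x | x - g ∈ N}
  have hKconv : Convex ℝ K := fun x hx y hy a b _ _ hab ↦ by
    have := hNcomb a b hx hy
    have hg : a • x + b • y - g = a • (x - g) + b • (y - g) := by
      rw [← eq_sub_iff_add_eq] at hab
      subst hab
      module
    rwa [← hg] at this
  have hKcl : IsClosed K := hNcl.preimage (continuous_id.sub continuous_const)
  have hgK : g ∈ K := by simpa [K] using hNcomb 0 0 (hNsub g) (hNsub g)
  obtain ⟨h, hhK, hmin⟩ := hKconv.exists_unique_minimal_norm hKcl ⟨g, hgK⟩
  have hThK : T h ∈ K := by simpa [K] using hNcomb 1 1 (hNsub h) hhK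
  have hfix : Function.IsFixedPt T h := hmin _ hThK (hT h)
  refine ⟨h, ?_⟩
  simpa using hcomb 1 (-1) (hfix.tendsto_birkhoffAverage ℝ _root_.id) hhK

end UniformConvex


/-- The `L_p`-mean ergodic theorem, `1 < p < ∞`: for a linear operator `T` on `L_p` with
`‖Tf‖ ≤ ‖f‖` and `g ∈ L_p`, the escape rate `τ = lim (1/n)‖∑_{k<n} Tᵏg‖` exists and the
ergodic averages `(1/n)∑_{k<n} Tᵏg` converge in `L_p`-norm to an element `h` with
`‖h‖ = τ` (so if `τ > 0` then `h = τg*` for a unit vector `g*`, and if `τ = 0` then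
`h = 0`). -/
theorem Lp_mean_ergodic_theorem
    {Ω : Type*} [MeasurableSpace Ω] (μ : Measure Ω) [IsProbabilityMeasure μ]
    (p : ℝ) (hp : 1 < p) [Fact (1 ≤ ENNReal.ofReal p)]
    (T : Lp ℝ (ENNReal.ofReal p) μ →ₗ[ℝ] Lp ℝ (ENNReal.ofReal p) μ)
    (hT : ∀ f, ‖T f‖ ≤ ‖f‖)
    (g : Lp ℝ (ENNReal.ofReal p) μ) :
    ∃ τ : ℝ,
      Tendsto (fun n : ℕ => ‖∑ k ∈ Finset.range n, (T ^ k) g‖ / n) atTop (𝓝 τ) ∧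
      ∃ h : Lp ℝ (ENNReal.ofReal p) μ, ‖h‖ = τ ∧
        Tendsto (fun n : ℕ => (n : ℝ)⁻¹ • ∑ k ∈ Finset.range n, (T ^ k) g) atTop (𝓝 h) := by
  have : UniformConvexSpace (Lp ℝ (ENNReal.ofReal p) μ) :=
    Lp.uniformConvexSpace (by simpa using hp) ENNReal.ofReal_ne_top
  obtain ⟨h, hh⟩ := T.exists_tendsto_birkhoffAverage hT g
  have hh' : Tendsto (fun n : ℕ ↦ (n : ℝ)⁻¹ • ∑ k ∈ Finset.range n, (T ^ k) g) atTop (𝓝 h) := by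
    simpa only [birkhoffAverage, birkhoffSum, id, ← Module.End.pow_apply] using hh
  refine ⟨‖h‖, ?_, h, rfl, hh'⟩
  simpa [norm_smul, div_eq_inv_mul] using hh'.norm
end
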